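/- None of the following three graphs is vertex-transitive: the odd double ladder of length 3 with matching {a_1b_7, b_1c_4, c_1a_3}; the odd double ladder of length 3 with matching {a_3b_1, b_7c_1, c_4a_1}; the odd double ladder of length 4 with matching {a_1b_7, b_1a_4, c_1c_5}. -/

import Mathlib

open SimpleGraph

/-- A simple graph is vertex-transitive if any vertex can be mapped to any other
by a graph automorphism. -/
def IsVertexTransitive {V : Type*} (G : SimpleGraph V) : Prop :=
  ∀ x y : V, ∃ φ : G ≃g G, φ x = y

/-- A graph `G` with at least `2*n+2` vertices is `n`-extendable if it has a matching
of size `n` and every matching of size `n` extends to a perfect matching. -/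
def IsNExtendable {V : Type*} [Fintype V] (G : SimpleGraph V) (n : ℕ) : Prop :=
  2 * n + 2 ≤ Fintype.card V ∧
    (∃ M : G.Subgraph, M.IsMatching ∧ M.edgeSet.ncard = n) ∧
    ∀ M : G.Subgraph, M.IsMatching → M.edgeSet.ncard = n →
      ∃ P : G.Subgraph, P.IsPerfectMatching ∧ M.edgeSet ⊆ P.edgeSet

/-- Vertices of the odd double ladder of length `k` (0-based indices):
`Sum.inl t` is `a_{t+1}`, `Sum.inr (Sum.inl t)` is `b_{t+1}`,
`Sum.inr (Sum.inr t)` is `c_{t+1}`. -/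
abbrev OddDLVert (k : ℕ) := Fin k ⊕ Fin (2 * k + 1) ⊕ Fin (k + 1)

/-- `p` is the `j`-th element of `{a_1, b_1, c_1}` in the odd double ladder. -/
def oddDLStart (k : ℕ) (j : Fin 3) (p : OddDLVert k) : Prop :=
  (j = 0 ∧ ∃ a : Fin k, p = Sum.inl a ∧ (a : ℕ) = 0) ∨
  (j = 1 ∧ ∃ b : Fin (2 * k + 1), p = Sum.inr (Sum.inl b) ∧ (b : ℕ) = 0) ∨
  (j = 2 ∧ ∃ c : Fin (k + 1), p = Sum.inr (Sum.inr c) ∧ (c : ℕ) = 0)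

/-- `p` is the `j`-th element of `{a_k, b_{2k+1}, c_{k+1}}` in the odd double ladder. -/
def oddDLEnd (k : ℕ) (j : Fin 3) (p : OddDLVert k) : Prop :=
  (j = 0 ∧ ∃ a : Fin k, p = Sum.inl a ∧ (a : ℕ) = k - 1) ∨
  (j = 1 ∧ ∃ b : Fin (2 * k + 1), p = Sum.inr (Sum.inl b) ∧ (b : ℕ) = 2 * k) ∨
  (j = 2 ∧ ∃ c : Fin (k + 1), p = Sum.inr (Sum.inr c) ∧ (c : ℕ) = k)

/-- The odd double ladder of length `k`, where the perfect matching between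
`{a_1, b_1, c_1}` and `{a_k, b_{2k+1}, c_{k+1}}` is given by the permutation `σ`
(the `j`-th start vertex is matched to the `σ j`-th end vertex, in the order `a, b, c`). -/
def oddDoubleLadder (k : ℕ) (σ : Equiv.Perm (Fin 3)) : SimpleGraph (OddDLVert k) :=
  SimpleGraph.fromRel fun p q =>
    -- a_i b_{2i}
    (∃ (a : Fin k) (b : Fin (2 * k + 1)),
      p = Sum.inl a ∧ q = Sum.inr (Sum.inl b) ∧ (b : ℕ) = 2 * (a : ℕ) + 1) ∨
    -- c_i b_{2i-1}
    (∃ (c : Fin (k + 1)) (b : Fin (2 * k + 1)),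
      p = Sum.inr (Sum.inr c) ∧ q = Sum.inr (Sum.inl b) ∧ (b : ℕ) = 2 * (c : ℕ)) ∨
    -- a_i a_{i+1}
    (∃ a a' : Fin k, p = Sum.inl a ∧ q = Sum.inl a' ∧ (a' : ℕ) = (a : ℕ) + 1) ∨
    -- b_i b_{i+1}
    (∃ b b' : Fin (2 * k + 1),
      p = Sum.inr (Sum.inl b) ∧ q = Sum.inr (Sum.inl b') ∧ (b' : ℕ) = (b : ℕ) + 1) ∨
    -- c_i c_{i+1}
    (∃ c c' : Fin (k + 1),
      p = Sum.inr (Sum.inr c) ∧ q = Sum.inr (Sum.inr c') ∧ (c' : ℕ) = (c : ℕ) + 1) ∨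
    -- the matching
    (∃ j : Fin 3, oddDLStart k j p ∧ oddDLEnd k (σ j) q)

/-- Vertices of the even double ladder of length `k` (0-based indices). -/
abbrev EvenDLVert (k : ℕ) := Fin k ⊕ Fin (2 * k) ⊕ Fin k

/-- `p` is the `j`-th element of `{a_1, b_1, c_1}` in the even double ladder. -/
def evenDLStart (k : ℕ) (j : Fin 3) (p : EvenDLVert k) : Prop :=
  (j = 0 ∧ ∃ a : Fin k, p = Sum.inl a ∧ (a : ℕ) = 0) ∨
  (j = 1 ∧ ∃ b : Fin (2 * k), p = Sum.inr (Sum.inl b) ∧ (b : ℕ) = 0) ∨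
  (j = 2 ∧ ∃ c : Fin k, p = Sum.inr (Sum.inr c) ∧ (c : ℕ) = 0)

/-- `p` is the `j`-th element of `{a_k, b_{2k}, c_k}` in the even double ladder. -/
def evenDLEnd (k : ℕ) (j : Fin 3) (p : EvenDLVert k) : Prop :=
  (j = 0 ∧ ∃ a : Fin k, p = Sum.inl a ∧ (a : ℕ) = k - 1) ∨
  (j = 1 ∧ ∃ b : Fin (2 * k), p = Sum.inr (Sum.inl b) ∧ (b : ℕ) = 2 * k - 1) ∨
  (j = 2 ∧ ∃ c : Fin k, p = Sum.inr (Sum.inr c) ∧ (c : ℕ) = k - 1)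

/-- The even double ladder of length `k`, with matching given by `σ` as above. -/
def evenDoubleLadder (k : ℕ) (σ : Equiv.Perm (Fin 3)) : SimpleGraph (EvenDLVert k) :=
  SimpleGraph.fromRel fun p q =>
    (∃ (a : Fin k) (b : Fin (2 * k)),
      p = Sum.inl a ∧ q = Sum.inr (Sum.inl b) ∧ (b : ℕ) = 2 * (a : ℕ) + 1) ∨
    (∃ (c : Fin k) (b : Fin (2 * k)),
      p = Sum.inr (Sum.inr c) ∧ q = Sum.inr (Sum.inl b) ∧ (b : ℕ) = 2 * (c : ℕ)) ∨
    (∃ a a' : Fin k, p = Sum.inl a ∧ q = Sum.inl a' ∧ (a' : ℕ) = (a : ℕ) + 1) ∨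
    (∃ b b' : Fin (2 * k),
      p = Sum.inr (Sum.inl b) ∧ q = Sum.inr (Sum.inl b') ∧ (b' : ℕ) = (b : ℕ) + 1) ∨
    (∃ c c' : Fin k,
      p = Sum.inr (Sum.inr c) ∧ q = Sum.inr (Sum.inr c') ∧ (c' : ℕ) = (c : ℕ) + 1) ∨
    (∃ j : Fin 3, evenDLStart k j p ∧ evenDLEnd k (σ j) q)

/-- Number of walks of length `n + 1` from `x` to `y`. -/
def walkCount {V : Type*} [Fintype V] [DecidableEq V] (G : SimpleGraph V) [DecidableRel G.Adj] :
    ℕ → V → V → ℕ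
  | 0, x, y => if G.Adj x y then 1 else 0
  | n + 1, x, y => ∑ z : V, if G.Adj x z then walkCount G n z y else 0

theorem walkCount_iso {V : Type*} [Fintype V] [DecidableEq V] (G : SimpleGraph V)
    [DecidableRel G.Adj] (φ : G ≃g G) (n : ℕ) (x y : V) :
    walkCount G n (φ x) (φ y) = walkCount G n x y := by
  induction n generalizing x with
  | zero => simp [walkCount, SimpleGraph.Iso.map_adj_iff]
  | succ n ih =>
    simp only [walkCount]
    rw [← Equiv.sum_comp φ.toEquiv]
    refine Finset.sum_congr rfl fun z _ => ?_
    have h1 : φ.toEquiv z = φ z := rfl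
    simp only [h1, ih, SimpleGraph.Iso.map_adj_iff]

theorem not_vt_of_walkCount {V : Type*} [Fintype V] [DecidableEq V] (G : SimpleGraph V)
    [DecidableRel G.Adj] (n : ℕ) (x y : V) (h : walkCount G n x x ≠ walkCount G n y y) :
    ¬ IsVertexTransitive G := by
  intro hv
  obtain ⟨φ, rfl⟩ := hv x y
  exact h (walkCount_iso G φ n x x).symm

/-- Quick form of `oddDLStart`. -/
def qStart (k : ℕ) (j : Fin 3) : OddDLVert k → Bool
  | Sum.inl a => decide (j = 0) && decide ((a : ℕ) = 0)
  | Sum.inr (Sum.inl b) => decide (j = 1) && decide ((b : ℕ) = 0)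
  | Sum.inr (Sum.inr c) => decide (j = 2) && decide ((c : ℕ) = 0)

/-- Quick form of `oddDLEnd`. -/
def qEnd (k : ℕ) (j : Fin 3) : OddDLVert k → Bool
  | Sum.inl a => decide (j = 0) && decide ((a : ℕ) = k - 1)
  | Sum.inr (Sum.inl b) => decide (j = 1) && decide ((b : ℕ) = 2 * k)
  | Sum.inr (Sum.inr c) => decide (j = 2) && decide ((c : ℕ) = k)

/-- Quick form of the ladder edges. -/
def qLad (k : ℕ) : OddDLVert k → OddDLVert k → Bool
  | Sum.inl a, Sum.inr (Sum.inl b) => decide ((b : ℕ) = 2 * (a : ℕ) + 1)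
  | Sum.inr (Sum.inr c), Sum.inr (Sum.inl b) => decide ((b : ℕ) = 2 * (c : ℕ))
  | Sum.inl a, Sum.inl a' => decide ((a' : ℕ) = (a : ℕ) + 1)
  | Sum.inr (Sum.inl b), Sum.inr (Sum.inl b') => decide ((b' : ℕ) = (b : ℕ) + 1)
  | Sum.inr (Sum.inr c), Sum.inr (Sum.inr c') => decide ((c' : ℕ) = (c : ℕ) + 1)
  | _, _ => false

/-- Quick form of the whole relation. -/
def qRel (k : ℕ) (σ : Equiv.Perm (Fin 3)) (p q : OddDLVert k) : Bool :=
  qLad k p q || (qStart k 0 p && qEnd k (σ 0) q) || (qStart k 1 p && qEnd k (σ 1) q) ||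
    (qStart k 2 p && qEnd k (σ 2) q)

theorem qStart_iff (k : ℕ) (j : Fin 3) (p : OddDLVert k) :
    oddDLStart k j p ↔ qStart k j p = true := by
  rcases p with a | b | c <;> simp [oddDLStart, qStart]

theorem qEnd_iff (k : ℕ) (j : Fin 3) (p : OddDLVert k) :
    oddDLEnd k j p ↔ qEnd k j p = true := by
  rcases p with a | b | c <;> simp [oddDLEnd, qEnd]

theorem adj_iff (k : ℕ) (σ : Equiv.Perm (Fin 3)) (p q : OddDLVert k) :
    (p ≠ q ∧ (qRel k σ p q || qRel k σ q p) = true) ↔ (oddDoubleLadder k σ).Adj p q := by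
  unfold oddDoubleLadder
  rw [SimpleGraph.fromRel_adj]
  have h3 : ∀ P : Fin 3 → Prop, (∃ j, P j) ↔ P 0 ∨ P 1 ∨ P 2 := fun P => by
    simp [Fin.exists_fin_succ]
  simp only [qStart_iff, qEnd_iff, h3]
  rcases p with a | b | c <;> rcases q with a' | b' | c' <;>
    simp [qRel, qLad, or_assoc]

instance (k : ℕ) (σ : Equiv.Perm (Fin 3)) : DecidableRel (oddDoubleLadder k σ).Adj :=
  fun p q => decidable_of_iff _ (adj_iff k σ p q)

/-- None of the three exceptional odd double ladders (length 3 with matching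
`{a_1 b_7, b_1 c_4, c_1 a_3}`, length 3 with matching `{a_3 b_1, b_7 c_1, c_4 a_1}`,
length 4 with matching `{a_1 b_9, b_1 a_4, c_1 c_5}`) is vertex-transitive. -/
theorem exceptional_oddDoubleLadders_not_vertexTransitive :
    ¬ IsVertexTransitive (oddDoubleLadder 3 (finRotate 3)) ∧
    ¬ IsVertexTransitive (oddDoubleLadder 3 (finRotate 3).symm) ∧
    ¬ IsVertexTransitive (oddDoubleLadder 4 (Equiv.swap (0 : Fin 3) 1)) := by
  refine ⟨not_vt_of_walkCount _ 4 (Sum.inl 2) (Sum.inl 0) ?_,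
    not_vt_of_walkCount _ 4 (Sum.inl 0) (Sum.inl 2) ?_,
    not_vt_of_walkCount _ 4 (Sum.inl 0) (Sum.inr (Sum.inl 4)) ?_⟩
  · decide +kernel
  · decide +kernel
  · decide +kernel
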